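/- Let H be a separable, infinite-dimensional complex Hilbert space. The set of all complex symmetric bounded linear operators on H is not closed in the operator-norm topology of B(H); that is, there exists a sequence of complex symmetric operators converging in operator norm to an operator that is not complex symmetric. -/

import Mathlib

open Filter ContinuousLinearMap

noncomputable section

/-- A conjugation on a complex Hilbert space `H` is a conjugate-linear, isometric
involution `C : H → H`. -/
def IsConjugation {H : Type*} [NormedAddCommGroup H] [InnerProductSpace ℂ H]
    (C : H → H) : Prop :=
  (∀ x y : H, C (x + y) = C x + C y) ∧
  (∀ (a : ℂ) (x : H), C (a • x) = (starRingEnd ℂ) a • C x) ∧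
  (∀ x : H, ‖C x‖ = ‖x‖) ∧
  (∀ x : H, C (C x) = x)

/-- A bounded operator `T` on a complex Hilbert space is complex symmetric if there is a
conjugation `C` with `T = C T* C`. -/
def IsComplexSymmetric {H : Type*} [NormedAddCommGroup H] [InnerProductSpace ℂ H]
    [CompleteSpace H] (T : H →L[ℂ] H) : Prop :=
  ∃ C : H → H, IsConjugation C ∧
    ∀ x : H, T x = C (ContinuousLinearMap.adjoint T (C x))

open scoped ENNReal lp

/-- A sequence dominated by an injective reindexing of an `ℓ²` sequence has its square sums
dominated accordingly. -/
lemma sum_norm_rpow_le_of_norm_le_comp {ι κ : Type*} {g : ι → ℂ} (f : ℓ²(κ, ℂ))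
    {φ : ι → κ} {M : ℝ} (hM : 0 ≤ M) (hφ : Set.InjOn φ (Function.support g))
    (hg : ∀ i, ‖g i‖ ≤ M * ‖f (φ i)‖) (s : Finset ι) :
    ∑ i ∈ s, ‖g i‖ ^ (2 : ℝ≥0∞).toReal ≤ (M * ‖f‖) ^ (2 : ℝ≥0∞).toReal := by
  classical
  have hp : 0 < (2 : ℝ≥0∞).toReal := by simp
  calc ∑ i ∈ s, ‖g i‖ ^ (2 : ℝ≥0∞).toReal
      = ∑ i ∈ s with g i ≠ 0, ‖g i‖ ^ (2 : ℝ≥0∞).toReal := by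
        refine (Finset.sum_filter_of_ne (p := fun i => g i ≠ 0) fun i _ h h0 => h ?_).symm
        simp [h0]
    _ ≤ ∑ i ∈ s with g i ≠ 0, M ^ (2 : ℝ≥0∞).toReal * ‖f (φ i)‖ ^ (2 : ℝ≥0∞).toReal := by
        refine Finset.sum_le_sum fun i _ => ?_
        rw [← Real.mul_rpow hM (norm_nonneg _)]
        exact Real.rpow_le_rpow (norm_nonneg _) (hg i) hp.le
    _ = M ^ (2 : ℝ≥0∞).toReal *
          ∑ j ∈ (s.filter fun i => g i ≠ 0).image φ, ‖f j‖ ^ (2 : ℝ≥0∞).toReal := by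
        rw [← Finset.mul_sum, Finset.sum_image]
        intro i hi j hj h
        exact hφ (Finset.mem_filter.1 hi).2 (Finset.mem_filter.1 hj).2 h
    _ ≤ M ^ (2 : ℝ≥0∞).toReal * ‖f‖ ^ (2 : ℝ≥0∞).toReal := by
        gcongr
        exact lp.sum_rpow_le_norm_rpow hp f _
    _ = (M * ‖f‖) ^ (2 : ℝ≥0∞).toReal := (Real.mul_rpow hM (norm_nonneg _)).symm

/-- The operator `f ↦ (i ↦ w i * f (φ i))` on `ℓ²`, for a bounded weight `w` and a map `φ` that is
injective on the support of `w`. -/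
def weightedComp {ι κ : Type*} (w : ι → ℂ) (φ : ι → κ) (M : ℝ) (hw : ∀ i, ‖w i‖ ≤ M)
    (hM : 0 ≤ M) (hφ : Set.InjOn φ (Function.support w)) : ℓ²(κ, ℂ) →L[ℂ] ℓ²(ι, ℂ) :=
  LinearMap.mkContinuous
    { toFun := fun f => ⟨fun i => w i * f (φ i),
        memℓp_gen' (sum_norm_rpow_le_of_norm_le_comp f hM
          (hφ.mono fun i hi => left_ne_zero_of_mul hi)
          fun i => by rw [norm_mul]; gcongr; exact hw i)⟩
      map_add' := fun f g => lp.ext (funext fun i => mul_add (w i) (f (φ i)) (g (φ i)))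
      map_smul' := fun a f => lp.ext (funext fun i => mul_left_comm (w i) a (f (φ i))) }
    M fun f => lp.norm_le_of_forall_sum_le (by simp) (by positivity)
      (sum_norm_rpow_le_of_norm_le_comp f hM (hφ.mono fun i hi => left_ne_zero_of_mul hi)
          fun i => by simp only [LinearMap.coe_mk, AddHom.coe_mk, norm_mul]; gcongr; exact hw i)

@[simp]
lemma weightedComp_apply {ι κ : Type*} {w : ι → ℂ} {φ : ι → κ} {M : ℝ} {hw : ∀ i, ‖w i‖ ≤ M}
    {hM : 0 ≤ M} {hφ : Set.InjOn φ (Function.support w)} (f : ℓ²(κ, ℂ)) (i : ι) :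
    weightedComp w φ M hw hM hφ f i = w i * f (φ i) := rfl

lemma norm_weightedComp_le {ι κ : Type*} {w : ι → ℂ} {φ : ι → κ} {M : ℝ} {hw : ∀ i, ‖w i‖ ≤ M}
    {hM : 0 ≤ M} {hφ : Set.InjOn φ (Function.support w)} :
    ‖weightedComp w φ M hw hM hφ‖ ≤ M :=
  LinearMap.mkContinuous_norm_le _ hM _

/-- The entrywise conjugation on `ℓ²` composed with a permutation of the coordinates. -/
def conjComp {ι : Type*} (σ : Equiv.Perm ι) (f : ℓ²(ι, ℂ)) : ℓ²(ι, ℂ) :=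
  star (weightedComp 1 σ 1 (by simp) zero_le_one σ.injective.injOn f)

@[simp]
lemma conjComp_apply {ι : Type*} (σ : Equiv.Perm ι) (f : ℓ²(ι, ℂ)) (i : ι) :
    conjComp σ f i = starRingEnd ℂ (f (σ i)) := by
  simp [conjComp]

lemma isConjugation_conjComp {ι : Type*} {σ : Equiv.Perm ι} (hσ : Function.Involutive σ) :
    IsConjugation (conjComp σ) := by
  have hle (f : ℓ²(ι, ℂ)) : ‖conjComp σ f‖ ≤ ‖f‖ := by
    rw [conjComp, norm_star]
    exact (le_of_opNorm_le _ norm_weightedComp_le f).trans_eq (one_mul _)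
  have hinv (f : ℓ²(ι, ℂ)) : conjComp σ (conjComp σ f) = f := by
    ext i
    simp [hσ i]
  refine ⟨fun f g => ?_, fun a f => ?_, fun f => (hle f).antisymm ?_, hinv⟩
  · ext i
    simp
  · ext i
    simp
  · simpa only [hinv] using hle (conjComp σ f)

/-- The weighted shift `e_n ↦ w (n + 1) • e_(n + 1)` on `ℓ²(ℕ)`. -/
def weightedShift (w : ℕ → ℂ) (M : ℝ) (h0 : w 0 = 0) (hw : ∀ n, ‖w n‖ ≤ M) :
    ℓ²(ℕ, ℂ) →L[ℂ] ℓ²(ℕ, ℂ) :=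
  weightedComp w Nat.pred M hw ((norm_nonneg _).trans (hw 0)) fun m hm n hn h => by
    have hm' : m ≠ 0 := fun h => hm (by rw [h, h0])
    have hn' : n ≠ 0 := fun h => hn (by rw [h, h0])
    simp only [Nat.pred_eq_sub_one] at h
    omega

@[simp]
lemma weightedShift_apply {w : ℕ → ℂ} {M : ℝ} {h0 : w 0 = 0} {hw : ∀ n, ‖w n‖ ≤ M}
    (f : ℓ²(ℕ, ℂ)) (n : ℕ) : weightedShift w M h0 hw f n = w n * f (n - 1) := rfl

lemma weightedShift_single {w : ℕ → ℂ} {M : ℝ} {h0 : w 0 = 0} {hw : ∀ n, ‖w n‖ ≤ M} (n : ℕ) :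
    weightedShift w M h0 hw (lp.single 2 n 1) = lp.single 2 (n + 1) (w (n + 1)) := by
  ext m
  rcases m with _ | m
  · simp [h0, Pi.single_apply]
  · by_cases h : m = n <;> simp [h]

lemma adjoint_weightedShift_apply {w : ℕ → ℂ} {M : ℝ} {h0 : w 0 = 0} {hw : ∀ n, ‖w n‖ ≤ M}
    (f : ℓ²(ℕ, ℂ)) (n : ℕ) :
    adjoint (weightedShift w M h0 hw) f n = starRingEnd ℂ (w (n + 1)) * f (n + 1) := by
  have h := adjoint_inner_right (weightedShift w M h0 hw) (lp.single 2 n 1) f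
  rw [weightedShift_single, lp.inner_single_left, lp.inner_single_left] at h
  simpa [mul_comm] using h

lemma isComplexSymmetric_weightedShift {w : ℕ → ℂ} {M : ℝ} {h0 : w 0 = 0} {hw : ∀ n, ‖w n‖ ≤ M}
    {σ : Equiv.Perm ℕ} (hσ : Function.Involutive σ) (hwσ : ∀ n, w (σ n + 1) = w n)
    (hσ' : ∀ n, w n ≠ 0 → σ (σ n + 1) = n - 1) :
    IsComplexSymmetric (weightedShift w M h0 hw) := by
  refine ⟨conjComp σ, isConjugation_conjComp hσ, fun f => ?_⟩
  ext n
  by_cases h : w n = 0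
  · simp [adjoint_weightedShift_apply, hwσ, h]
  · simp [adjoint_weightedShift_apply, hwσ, hσ' n h]

lemma IsComplexSymmetric.adjoint_injective {H : Type*} [NormedAddCommGroup H]
    [InnerProductSpace ℂ H] [CompleteSpace H] {T : H →L[ℂ] H} (hT : IsComplexSymmetric T)
    (hinj : ∀ x, T x = 0 → x = 0) (y : H) (hy : adjoint T y = 0) : y = 0 := by
  obtain ⟨C, ⟨-, -, hnorm, hinv⟩, hC⟩ := hT
  have hC0 : C 0 = 0 := by simpa using hnorm 0
  have : C y = 0 := hinj _ (by rw [hC, hinv, hy, hC0])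
  rw [← hinv y, this, hC0]

lemma not_isComplexSymmetric_weightedShift {w : ℕ → ℂ} {M : ℝ} {h0 : w 0 = 0}
    {hw : ∀ n, ‖w n‖ ≤ M} (hne : ∀ n, w (n + 1) ≠ 0) :
    ¬ IsComplexSymmetric (weightedShift w M h0 hw) := by
  intro h
  have key := h.adjoint_injective (fun f hf => ?_) (lp.single 2 0 1) ?_
  · simpa using congr_arg (fun f : ℓ²(ℕ, ℂ) => f 0) key
  · ext n
    simpa [hne] using congr_arg (fun f : ℓ²(ℕ, ℂ) => f (n + 1)) hf
  · ext n
    simp [adjoint_weightedShift_apply]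

lemma IsComplexSymmetric.conjStarAlgEquiv {H K : Type*} [NormedAddCommGroup H]
    [InnerProductSpace ℂ H] [CompleteSpace H] [NormedAddCommGroup K] [InnerProductSpace ℂ K]
    [CompleteSpace K] (e : H ≃ₗᵢ[ℂ] K) {T : H →L[ℂ] H} (hT : IsComplexSymmetric T) :
    IsComplexSymmetric (e.conjStarAlgEquiv T) := by
  obtain ⟨C, ⟨hadd, hsmul, hnorm, hinv⟩, hC⟩ := hT
  refine ⟨fun x => e (C (e.symm x)), ⟨?_, ?_, ?_, ?_⟩, fun x => ?_⟩
  · simp [hadd]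
  · simp [hsmul]
  · simp [hnorm]
  · simp [hinv]
  · rw [← ContinuousLinearMap.star_eq_adjoint, ← map_star]
    simp [ContinuousLinearMap.star_eq_adjoint, hC]

/-- The weights `1, 1/2, 1, 1/4, 1, 1/2, 1, 1/8, …` of the Kakutani shift. -/
def kakutaniWeight (n : ℕ) : ℂ := if n = 0 then 0 else (1 / 2) ^ padicValNat 2 n

/-- The Kakutani weights with those smaller than `2 ^ (1 - k)` replaced by zero. -/
def truncatedKakutaniWeight (k n : ℕ) : ℂ := if 2 ^ k ∣ n then 0 else kakutaniWeight n

lemma norm_kakutaniWeight_le {k n : ℕ} (h : 2 ^ k ∣ n) : ‖kakutaniWeight n‖ ≤ (1 / 2) ^ k := by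
  rw [kakutaniWeight]
  split_ifs with hn
  · simp
  · rw [norm_pow]
    have : k ≤ padicValNat 2 n := (padicValNat_dvd_iff_le hn).1 h
    simpa using pow_le_pow_of_le_one (by norm_num : (0 : ℝ) ≤ 1 / 2) (by norm_num) this

lemma norm_kakutaniWeight_le_one (n : ℕ) : ‖kakutaniWeight n‖ ≤ 1 := by
  simpa using norm_kakutaniWeight_le (k := 0) (n := n) (by simp)

lemma norm_truncatedKakutaniWeight_le_one (k n : ℕ) : ‖truncatedKakutaniWeight k n‖ ≤ 1 := by
  rw [truncatedKakutaniWeight]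
  split_ifs
  · simp
  · exact norm_kakutaniWeight_le_one n

lemma truncatedKakutaniWeight_congr {k m n : ℕ} (h : 2 ^ k ∣ m + n) :
    truncatedKakutaniWeight k m = truncatedKakutaniWeight k n := by
  have hdvd {j : ℕ} (hj : j ≤ k) : 2 ^ j ∣ m ↔ 2 ^ j ∣ n :=
    by
    have := (pow_dvd_pow 2 hj).trans h
    exact ⟨fun hm => (Nat.dvd_add_right hm).1 this, fun hn => (Nat.dvd_add_left hn).1 this⟩
  by_cases hm : 2 ^ k ∣ m
  · simp [truncatedKakutaniWeight, hm, (hdvd le_rfl).1 hm]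
  have hn : ¬ 2 ^ k ∣ n := fun h => hm ((hdvd le_rfl).2 h)
  have hm0 : m ≠ 0 := by rintro rfl; simp at hm
  have hn0 : n ≠ 0 := by rintro rfl; simp at hn
  have hmk : padicValNat 2 m ≤ k := (not_le.1 fun h => hm ((padicValNat_dvd_iff_le hm0).2 h)).le
  have hnk : padicValNat 2 n ≤ k := (not_le.1 fun h => hn ((padicValNat_dvd_iff_le hn0).2 h)).le
  have : padicValNat 2 m = padicValNat 2 n := le_antisymm
    ((padicValNat_dvd_iff_le hn0).1 ((hdvd hmk).1 pow_padicValNat_dvd))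
    ((padicValNat_dvd_iff_le hm0).1 ((hdvd hnk).2 pow_padicValNat_dvd))
  simp [truncatedKakutaniWeight, kakutaniWeight, hm, hn, hm0, hn0, this]

/-- The map reversing each of the intervals `[N * q, N * (q + 1))`. -/
def blockReverse (N n : ℕ) : ℕ := N * (n / N) + (N - 1 - n % N)

lemma blockReverse_mul_add {N q r : ℕ} (hr : r < N) :
    blockReverse N (N * q + r) = N * q + (N - 1 - r) := by
  rw [blockReverse, Nat.mul_add_div (by omega), Nat.div_eq_of_lt hr, Nat.mul_add_mod,
    Nat.mod_eq_of_lt hr, add_zero]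

lemma blockReverse_involutive {N : ℕ} (hN : 0 < N) : Function.Involutive (blockReverse N) := by
  intro n
  have hr := Nat.mod_lt n hN
  rw [← Nat.div_add_mod n N, blockReverse_mul_add hr, blockReverse_mul_add (by omega)]
  omega

lemma dvd_blockReverse_add_one_add {N : ℕ} (hN : 0 < N) (n : ℕ) :
    N ∣ blockReverse N n + 1 + n := by
  have hr := Nat.mod_lt n hN
  refine ⟨2 * (n / N) + 1, ?_⟩
  rw [blockReverse]
  have := Nat.div_add_mod n N
  rw [mul_add, mul_left_comm, mul_one]
  omega

lemma blockReverse_blockReverse_add_one {N n : ℕ} (hN : 0 < N) (hn : ¬ N ∣ n) :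
    blockReverse N (blockReverse N n + 1) = n - 1 := by
  have hr := Nat.mod_lt n hN
  have hr0 : n % N ≠ 0 := fun h => hn (Nat.dvd_of_mod_eq_zero h)
  have := Nat.div_add_mod n N
  rw [show blockReverse N n + 1 = N * (n / N) + (N - n % N) by rw [blockReverse]; omega,
    blockReverse_mul_add (by omega)]
  omega

/-- The Kakutani shift. -/
def kakutaniShift : ℓ²(ℕ, ℂ) →L[ℂ] ℓ²(ℕ, ℂ) :=
  weightedShift kakutaniWeight 1 (by simp [kakutaniWeight]) norm_kakutaniWeight_le_one

/-- The direct sum of finite-dimensional weighted shifts obtained from the Kakutani shift by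
discarding the weights smaller than `2 ^ (1 - k)`. -/
def truncatedKakutaniShift (k : ℕ) : ℓ²(ℕ, ℂ) →L[ℂ] ℓ²(ℕ, ℂ) :=
  weightedShift (truncatedKakutaniWeight k) 1 (by simp [truncatedKakutaniWeight])
    (norm_truncatedKakutaniWeight_le_one k)

lemma not_isComplexSymmetric_kakutaniShift : ¬ IsComplexSymmetric kakutaniShift :=
  not_isComplexSymmetric_weightedShift fun n => by simp [kakutaniWeight]

lemma isComplexSymmetric_truncatedKakutaniShift (k : ℕ) :
    IsComplexSymmetric (truncatedKakutaniShift k) := by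
  have hN : 0 < 2 ^ k := by positivity
  have hσ := blockReverse_involutive hN
  refine isComplexSymmetric_weightedShift (σ := hσ.toPerm) hσ (fun n => ?_) fun n hn => ?_
  · exact truncatedKakutaniWeight_congr (dvd_blockReverse_add_one_add hN n)
  · exact blockReverse_blockReverse_add_one hN fun h => hn (by simp [truncatedKakutaniWeight, h])

lemma norm_truncatedKakutaniShift_sub_le (k : ℕ) :
    ‖truncatedKakutaniShift k - kakutaniShift‖ ≤ (1 / 2) ^ k := by
  have h : truncatedKakutaniShift k - kakutaniShift =
      weightedShift (fun n => truncatedKakutaniWeight k n - kakutaniWeight n) ((1 / 2) ^ k)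
        (by simp [truncatedKakutaniWeight, kakutaniWeight]) (fun n => by
          rw [truncatedKakutaniWeight]
          split_ifs with h
          · simpa using norm_kakutaniWeight_le h
          · simp) := by
    ext f n
    simp [truncatedKakutaniShift, kakutaniShift, sub_mul]
  rw [h]
  exact norm_weightedComp_le

lemma tendsto_truncatedKakutaniShift :
    Tendsto truncatedKakutaniShift atTop (nhds kakutaniShift) := by
  rw [tendsto_iff_norm_sub_tendsto_zero]
  exact squeeze_zero (fun _ => norm_nonneg _) norm_truncatedKakutaniShift_sub_le
    (tendsto_pow_atTop_nhds_zero_of_lt_one (by norm_num) (by norm_num))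

lemma Orthonormal.countable {ι H : Type*} [NormedAddCommGroup H] [InnerProductSpace ℂ H]
    [TopologicalSpace.SeparableSpace H] {v : ι → H} (hv : Orthonormal ℂ v) : Countable ι := by
  refine Pairwise.countable_of_isOpen_disjoint (s := fun i => Metric.ball (v i) (1 / 2))
    (fun i j hij => ?_) (fun _ => Metric.isOpen_ball) fun i => ⟨v i, by simp⟩
  refine Metric.ball_disjoint_ball ?_
  have h : ‖v i - v j‖ ^ 2 = 2 := by
    rw [@norm_sub_sq ℂ, hv.1, hv.1, hv.2 hij]
    norm_num
  rw [dist_eq_norm]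
  nlinarith [norm_nonneg (v i - v j)]

lemma nonempty_linearIsometryEquiv_ell_two (H : Type*) [NormedAddCommGroup H]
    [InnerProductSpace ℂ H] [CompleteSpace H] [TopologicalSpace.SeparableSpace H]
    (hdim : ¬ FiniteDimensional ℂ H) : Nonempty (H ≃ₗᵢ[ℂ] ℓ²(ℕ, ℂ)) := by
  obtain ⟨s, b, -⟩ := exists_hilbertBasis ℂ H
  have : Countable s := b.orthonormal.countable
  have : Infinite s := by
    by_contra h
    have : Finite s := not_infinite_iff_finite.1 h
    have := Fintype.ofFinite s
    exact hdim b.toOrthonormalBasis.toBasis.finiteDimensional_of_finite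
  obtain ⟨e⟩ := nonempty_equiv_of_countable (α := ℕ) (β := s)
  refine ⟨(HilbertBasis.mk (b.orthonormal.comp e e.injective) ?_).repr⟩
  rw [e.surjective.range_comp, b.dense_span]

/-- On a separable, infinite-dimensional complex Hilbert space `H`, the set of
complex symmetric operators is not closed in the operator-norm topology of `B(H)`: there is a
sequence of complex symmetric operators converging in operator norm to an operator that is not
complex symmetric. -/
theorem complexSymmetric_not_normClosed
    (H : Type*) [NormedAddCommGroup H] [InnerProductSpace ℂ H] [CompleteSpace H]
    [TopologicalSpace.SeparableSpace H] (hdim : ¬ FiniteDimensional ℂ H) :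
    ¬ IsClosed {T : H →L[ℂ] H | IsComplexSymmetric T} ∧
    ∃ (Tn : ℕ → H →L[ℂ] H) (T : H →L[ℂ] H),
      (∀ n, IsComplexSymmetric (Tn n)) ∧
      Tendsto Tn atTop (nhds T) ∧
      ¬ IsComplexSymmetric T := by
  obtain ⟨e⟩ := nonempty_linearIsometryEquiv_ell_two H hdim
  have hseq : ∃ (Tn : ℕ → H →L[ℂ] H) (T : H →L[ℂ] H), (∀ n, IsComplexSymmetric (Tn n)) ∧
      Tendsto Tn atTop (nhds T) ∧ ¬ IsComplexSymmetric T := by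
    refine ⟨fun k => e.symm.conjStarAlgEquiv (truncatedKakutaniShift k),
      e.symm.conjStarAlgEquiv kakutaniShift,
      fun k => (isComplexSymmetric_truncatedKakutaniShift k).conjStarAlgEquiv e.symm, ?_,
      fun h => not_isComplexSymmetric_kakutaniShift ?_⟩
    · have hcont : Continuous e.symm.conjStarAlgEquiv := by
        simp only [funext e.symm.conjStarAlgEquiv_apply]
        fun_prop
      exact (hcont.tendsto _).comp tendsto_truncatedKakutaniShift
    · convert h.conjStarAlgEquiv e
      ext1 f
      simp
  refine ⟨fun hclosed => ?_, hseq⟩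
  obtain ⟨Tn, T, hTn, hlim, hT⟩ := hseq
  exact hT (hclosed.mem_of_tendsto hlim (Eventually.of_forall hTn))
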